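/- arXiv:1611.06019 — 2 statements merged into one kernel-verified Lean document; each statement's English description precedes it below -/
import Mathlib

section
/- Let Y ⊆ Λ and consider two families of coupling constants that agree except in the Y-component: all couplings nonnegative. Then for any X ⊆ Λ and β > 0, the classical XY Gibbs expectation ⟨σ¹_X⟩ is nondecreasing in J¹_Y (i.e. if J¹_Y ≤ J̃¹_Y and all other couplings are equal and nonnegative, then ⟨σ¹_X⟩ computed with J¹_Y is ≤ ⟨σ¹_X⟩ computed with J̃¹_Y), and ⟨σ¹_X⟩ is nonincreasing in J²_Y. -/
open MeasureTheory Real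

/-- The box `[0, 2π]^Λ` of classical XY configurations. -/
def xyBox (Λ : Type*) [Fintype Λ] : Set (Λ → ℝ) :=
  Set.univ.pi fun _ : Λ => Set.Icc (0 : ℝ) (2 * π)

/-- Classical XY Hamiltonian with many-body couplings `J1, J2` indexed by subsets of `Λ`:
`H(φ) = −Σ_{A⊆Λ} (J¹_A ∏_{x∈A} cos φ_x + J²_A ∏_{x∈A} sin φ_x)`. -/
noncomputable def xyHam {Λ : Type*} [Fintype Λ] (J1 J2 : Finset Λ → ℝ) (φ : Λ → ℝ) : ℝ :=
  - ∑ A : Finset Λ, (J1 A * ∏ x ∈ A, Real.cos (φ x) + J2 A * ∏ x ∈ A, Real.sin (φ x))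

/-- Gibbs expectation of a functional `f` for the classical XY model at inverse temperature `β`:
`⟨f⟩ = Z⁻¹ ∫_{[0,2π]^Λ} f(φ) e^{−βH(φ)} ∏ dφ_x/(2π)` (the normalisations `1/(2π)` cancel in
the ratio). -/
noncomputable def xyGibbs {Λ : Type*} [Fintype Λ] (J1 J2 : Finset Λ → ℝ) (β : ℝ)
    (f : (Λ → ℝ) → ℝ) : ℝ :=
  (∫ φ in xyBox Λ, f φ * Real.exp (-β * xyHam J1 J2 φ)) /
  (∫ φ in xyBox Λ, Real.exp (-β * xyHam J1 J2 φ))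

/-- `σ¹_X = ∏_{x∈X} cos φ_x`. -/
noncomputable def sigma1 {Λ : Type*} (X : Finset Λ) (φ : Λ → ℝ) : ℝ :=
  ∏ x ∈ X, Real.cos (φ x)

/-- `σ²_X = ∏_{x∈X} sin φ_x`. -/
noncomputable def sigma2 {Λ : Type*} (X : Finset Λ) (φ : Λ → ℝ) : ℝ :=
  ∏ x ∈ X, Real.sin (φ x)

theorem integral_cos_pow_mul_sin_pow_zero_pi_nonneg (m n : ℕ) :
    0 ≤ ∫ v in (0 : ℝ)..π, cos v ^ m * sin v ^ n := by
  rcases Nat.even_or_odd m with hm | hm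
  · refine intervalIntegral.integral_nonneg pi_pos.le fun v hv => ?_
    exact mul_nonneg (hm.pow_nonneg _) (pow_nonneg (sin_nonneg_of_nonneg_of_le_pi hv.1 hv.2) _)
  · have h := intervalIntegral.integral_comp_sub_left
      (fun v => cos v ^ m * sin v ^ n) (a := 0) (b := π) π
    simp only [cos_pi_sub, sin_pi_sub, hm.neg_pow, neg_mul, sub_self, sub_zero,
      intervalIntegral.integral_neg] at h
    linarith

theorem integral_cos_pow_mul_sin_pow_zero_two_pi_nonneg (m n : ℕ) :
    0 ≤ ∫ v in (0 : ℝ)..(2 * π), cos v ^ m * sin v ^ n := by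
  have hi : ∀ a b : ℝ, IntervalIntegrable (fun v => cos v ^ m * sin v ^ n) volume a b :=
    fun a b => (by fun_prop : Continuous fun v => cos v ^ m * sin v ^ n).intervalIntegrable a b
  have h := intervalIntegral.integral_comp_add_right
    (fun v => cos v ^ m * sin v ^ n) (a := 0) (b := π) π
  rw [zero_add, ← two_mul] at h
  rw [← intervalIntegral.integral_add_adjacent_intervals (hi 0 π) (hi π (2 * π)), ← h]
  have hs : ∀ v : ℝ, cos (v + π) ^ m * sin (v + π) ^ n
      = (-1) ^ (m + n) * (cos v ^ m * sin v ^ n) := fun v => by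
    rw [cos_add_pi, sin_add_pi, neg_pow, neg_pow (sin v)]; ring
  simp only [hs, intervalIntegral.integral_const_mul]
  have h0 := integral_cos_pow_mul_sin_pow_zero_pi_nonneg m n
  rcases neg_one_pow_eq_or ℝ (m + n) with h1 | h1 <;> rw [h1] <;> linarith

/-- The monomials in the Ginibre variables at one site. -/
noncomputable def ginibreMonomial (a b c d : ℕ) (p : ℝ × ℝ) : ℝ :=
  (cos p.1 + cos p.2) ^ a * (cos p.1 - cos p.2) ^ b * (sin p.1 + sin p.2) ^ c *
    (sin p.2 - sin p.1) ^ d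

theorem continuous_ginibreMonomial (a b c d : ℕ) : Continuous (ginibreMonomial a b c d) := by
  unfold ginibreMonomial
  fun_prop

theorem ginibreMonomial_rotate (a b c d : ℕ) (x v : ℝ) :
    ginibreMonomial a b c d (x, x + 2 * v) =
      2 ^ (a + b + c + d) * ((cos (v + x) ^ (a + d) * sin (v + x) ^ (b + c)) *
        (cos v ^ (a + c) * sin v ^ (b + d))) := by
  obtain ⟨u, rfl⟩ : ∃ u, x = u - v := ⟨x + v, by ring⟩
  have h1 : u - v + 2 * v = u + v := by ring
  have h2 : v + (u - v) = u := by ring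
  simp only [ginibreMonomial, h1, h2, cos_sub, cos_add, sin_sub, sin_add]
  ring_nf

theorem integral_ginibreMonomial_nonneg (a b c d : ℕ) :
    0 ≤ ∫ p, ginibreMonomial a b c d p ∂((volume.restrict (Set.Icc (0 : ℝ) (2 * π))).prod
      (volume.restrict (Set.Icc (0 : ℝ) (2 * π)))) := by
  have hc := continuous_ginibreMonomial a b c d
  have hint : Integrable (ginibreMonomial a b c d)
      ((volume.restrict (Set.Icc (0 : ℝ) (2 * π))).prod
        (volume.restrict (Set.Icc (0 : ℝ) (2 * π)))) := by
    rw [Measure.prod_restrict]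
    exact hc.continuousOn.integrableOn_compact (isCompact_Icc.prod isCompact_Icc)
  have h2pi : (0 : ℝ) ≤ 2 * π := by positivity
  rw [integral_prod _ hint]
  simp only [integral_Icc_eq_integral_Ioc, ← intervalIntegral.integral_of_le h2pi]
  have hinner : ∀ x : ℝ, ∫ y in (0 : ℝ)..(2 * π), ginibreMonomial a b c d (x, y) =
      2 ^ (a + b + c + d + 1) * ∫ v in (0 : ℝ)..π,
        (cos (v + x) ^ (a + d) * sin (v + x) ^ (b + c)) *
          (cos v ^ (a + c) * sin v ^ (b + d)) := by
    intro x
    have hper : Function.Periodic (fun y => ginibreMonomial a b c d (x, y)) (2 * π) := fun y => by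
      simp [ginibreMonomial]
    have h1 := hper.intervalIntegral_add_eq 0 x
    have h2 := intervalIntegral.integral_comp_add_mul
      (fun y => ginibreMonomial a b c d (x, y)) (a := 0) (b := π) two_ne_zero x
    rw [zero_add] at h1
    rw [mul_zero, add_zero] at h2
    simp only [ginibreMonomial_rotate, intervalIntegral.integral_const_mul, smul_eq_mul] at h2
    rw [h1, pow_succ, mul_right_comm, h2]
    ring
  simp only [hinner, intervalIntegral.integral_const_mul]
  refine mul_nonneg (by positivity) ?_
  have hcF : Continuous (Function.uncurry fun x v : ℝ =>
      (cos (v + x) ^ (a + d) * sin (v + x) ^ (b + c)) *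
          (cos v ^ (a + c) * sin v ^ (b + d))) := by
    unfold Function.uncurry
    fun_prop
  rw [intervalIntegral_intervalIntegral_swap]
  swap
  · exact (hcF.continuousOn.integrableOn_compact (isCompact_uIcc.prod isCompact_uIcc)).mono_set
      (Set.prod_mono Set.uIoc_subset_uIcc Set.uIoc_subset_uIcc)
  have hv : ∀ v : ℝ, ∫ x in (0 : ℝ)..(2 * π), cos (v + x) ^ (a + d) * sin (v + x) ^ (b + c) =
      ∫ x in (0 : ℝ)..(2 * π), cos x ^ (a + d) * sin x ^ (b + c) := by
    intro v
    have hper : Function.Periodic (fun x => cos x ^ (a + d) * sin x ^ (b + c)) (2 * π) :=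
      fun y => by simp
    have h1 := hper.intervalIntegral_add_eq v 0
    have h2 := intervalIntegral.integral_comp_add_left
      (fun x => cos x ^ (a + d) * sin x ^ (b + c)) (a := 0) (b := 2 * π) v
    rw [h2, add_zero, h1, zero_add]
  simp only [intervalIntegral.integral_mul_const, hv, intervalIntegral.integral_const_mul]
  exact mul_nonneg (integral_cos_pow_mul_sin_pow_zero_two_pi_nonneg _ _)
    (integral_cos_pow_mul_sin_pow_zero_pi_nonneg _ _)

theorem ginibreMonomial_mul (a b c d a' b' c' d' : ℕ) (p : ℝ × ℝ) :
    ginibreMonomial a b c d p * ginibreMonomial a' b' c' d' p =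
      ginibreMonomial (a + a') (b + b') (c + c') (d + d') p := by
  simp only [ginibreMonomial, pow_add]
  ring

open BoundedContinuousFunction

/-- A closed subsemiring containing the nonnegative scalars is stable under the exponential. -/
theorem Subsemiring.exp_mem_of_isClosed {A : Type*} [NormedRing A] [NormedAlgebra ℝ A]
    [CompleteSpace A] {S : Subsemiring A} (hS : IsClosed (S : Set A))
    (hr : ∀ r : ℝ, 0 ≤ r → algebraMap ℝ A r ∈ S) {a : A} (ha : a ∈ S) :
    NormedSpace.exp a ∈ S := by
  refine hS.mem_of_tendsto (NormedSpace.exp_series_hasSum_exp' (𝕂 := ℝ) a)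
    (Filter.Eventually.of_forall fun s => sum_mem fun n _ => ?_)
  rw [Algebra.smul_def]
  exact mul_mem (hr _ (by positivity)) (pow_mem ha n)

/-- Pairs whose sum and difference both lie in the given subsemiring. -/
def ginibrePairs {A : Type*} [CommRing A] [Algebra ℝ A] (K : Subsemiring A)
    (hK : algebraMap ℝ A 2⁻¹ ∈ K) : Subsemiring (A × A) where
  carrier := {q | q.1 + q.2 ∈ K ∧ q.1 - q.2 ∈ K}
  zero_mem' := by simp
  one_mem' := by
    refine ⟨add_mem (one_mem K) (one_mem K), ?_⟩
    simp
  add_mem' := by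
    rintro p q ⟨hp, hp'⟩ ⟨hq, hq'⟩
    refine ⟨?_, ?_⟩
    · convert add_mem hp hq using 1
      simp only [Prod.fst_add, Prod.snd_add]; ring
    · convert add_mem hp' hq' using 1
      simp only [Prod.fst_add, Prod.snd_add]; ring
  mul_mem' := by
    have h2 : algebraMap ℝ A 2⁻¹ * 2 = 1 := by
      rw [← map_ofNat (algebraMap ℝ A) 2, ← map_mul]; norm_num
    rintro p q ⟨hp, hp'⟩ ⟨hq, hq'⟩
    refine ⟨?_, ?_⟩
    · convert mul_mem hK (add_mem (mul_mem hp hq) (mul_mem hp' hq')) using 1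
      simp only [Prod.fst_mul, Prod.snd_mul]
      linear_combination (-(p.1 * q.1 + p.2 * q.2)) * h2
    · convert mul_mem hK (add_mem (mul_mem hp hq') (mul_mem hp' hq)) using 1
      simp only [Prod.fst_mul, Prod.snd_mul]
      linear_combination (-(p.1 * q.1 - p.2 * q.2)) * h2

theorem isClosed_ginibrePairs {A : Type*} [NormedCommRing A] [NormedAlgebra ℝ A]
    {K : Subsemiring A} (hK : algebraMap ℝ A 2⁻¹ ∈ K) (hc : IsClosed (K : Set A)) :
    IsClosed (ginibrePairs K hK : Set (A × A)) :=
  (hc.preimage (continuous_fst.add continuous_snd)).inter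
    (hc.preimage (continuous_fst.sub continuous_snd))

section Copies

variable {Λ : Type*}

theorem BoundedContinuousFunction.exp_apply {α : Type*} [TopologicalSpace α] (F : α →ᵇ ℝ) (p : α) :
    NormedSpace.exp F p = Real.exp (F p) := by
  have h := (NormedSpace.exp_series_hasSum_exp' (𝕂 := ℝ) F).mapL
    (BoundedContinuousFunction.evalCLM ℝ p)
  have h' := NormedSpace.exp_series_hasSum_exp' (𝕂 := ℝ) (F p)
  rw [Real.exp_eq_exp_ℝ]
  refine HasSum.unique h ?_
  simpa using h'

/-- Restriction of an observable to the first copy of a doubled configuration. -/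
def firstCopy : ((Λ → ℝ) →ᵇ ℝ) →+* ((Λ → ℝ × ℝ) →ᵇ ℝ) where
  toFun F := F.compContinuous ⟨fun p x => (p x).1, by fun_prop⟩
  map_zero' := rfl
  map_one' := rfl
  map_add' _ _ := rfl
  map_mul' _ _ := rfl

/-- Restriction of an observable to the second copy of a doubled configuration. -/
def secondCopy : ((Λ → ℝ) →ᵇ ℝ) →+* ((Λ → ℝ × ℝ) →ᵇ ℝ) where
  toFun F := F.compContinuous ⟨fun p x => (p x).2, by fun_prop⟩
  map_zero' := rfl
  map_one' := rfl
  map_add' _ _ := rfl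
  map_mul' _ _ := rfl

@[simp]
theorem firstCopy_apply (F : (Λ → ℝ) →ᵇ ℝ) (p : Λ → ℝ × ℝ) :
    firstCopy F p = F fun x => (p x).1 := rfl

@[simp]
theorem secondCopy_apply (F : (Λ → ℝ) →ᵇ ℝ) (p : Λ → ℝ × ℝ) :
    secondCopy F p = F fun x => (p x).2 := rfl

theorem continuous_firstCopy : Continuous (firstCopy (Λ := Λ)) :=
  BoundedContinuousFunction.continuous_compContinuous _

theorem continuous_secondCopy : Continuous (secondCopy (Λ := Λ)) :=
  BoundedContinuousFunction.continuous_compContinuous _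

/-- The observable `cos φ_x`. -/
noncomputable def cosAt (x : Λ) : (Λ → ℝ) →ᵇ ℝ :=
  BoundedContinuousFunction.ofNormedAddCommGroup (fun φ => cos (φ x)) (by fun_prop) 1
    fun φ => abs_cos_le_one (φ x)

/-- The observable `sin φ_x`. -/
noncomputable def sinAt (x : Λ) : (Λ → ℝ) →ᵇ ℝ :=
  BoundedContinuousFunction.ofNormedAddCommGroup (fun φ => sin (φ x)) (by fun_prop) 1
    fun φ => abs_sin_le_one (φ x)

@[simp]
theorem cosAt_apply (x : Λ) (φ : Λ → ℝ) : cosAt x φ = cos (φ x) := rfl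

@[simp]
theorem sinAt_apply (x : Λ) (φ : Λ → ℝ) : sinAt x φ = sin (φ x) := rfl

@[simp]
theorem prod_cosAt_apply (X : Finset Λ) (φ : Λ → ℝ) : (∏ x ∈ X, cosAt x) φ = sigma1 X φ := by
  simp [sigma1]

@[simp]
theorem prod_sinAt_apply (X : Finset Λ) (φ : Λ → ℝ) : (∏ x ∈ X, sinAt x) φ = sigma2 X φ := by
  simp [sigma2]

theorem exp_doubled (F : (Λ → ℝ) →ᵇ ℝ) :
    NormedSpace.exp (firstCopy F + secondCopy F) =
      firstCopy (NormedSpace.exp F) * secondCopy (NormedSpace.exp F) := by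
  ext p
  simp [BoundedContinuousFunction.exp_apply, Real.exp_add]

theorem exp_add_eq_mul (F G : (Λ → ℝ) →ᵇ ℝ) :
    NormedSpace.exp (F + G) = NormedSpace.exp F * NormedSpace.exp G := by
  ext φ
  simp [BoundedContinuousFunction.exp_apply, Real.exp_add]

end Copies

section Cone

variable (Λ : Type*) [Fintype Λ]

/-- Nonnegative multiples of monomials in the Ginibre variables of a doubled configuration. -/
def ginibreMonomials : Submonoid ((Λ → ℝ × ℝ) →ᵇ ℝ) where
  carrier := {F | ∃ r : ℝ, 0 ≤ r ∧ ∃ a b c d : Λ → ℕ,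
    ∀ p, F p = r * ∏ x, ginibreMonomial (a x) (b x) (c x) (d x) (p x)}
  one_mem' := ⟨1, zero_le_one, 0, 0, 0, 0, fun p => by simp [ginibreMonomial]⟩
  mul_mem' := by
    rintro F G ⟨r, hr, a, b, c, d, hF⟩ ⟨s, hs, a', b', c', d', hG⟩
    refine ⟨r * s, mul_nonneg hr hs, a + a', b + b', c + c', d + d', fun p => ?_⟩
    simp only [coe_mul, Pi.mul_apply, hF, hG, Pi.add_apply, ← ginibreMonomial_mul,
      Finset.prod_mul_distrib]
    ring

/-- The closed cone generated by the Ginibre variables, as a subsemiring. -/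
noncomputable def ginibreCone : Subsemiring ((Λ → ℝ × ℝ) →ᵇ ℝ) :=
  (Subsemiring.closure (ginibreMonomials Λ : Set ((Λ → ℝ × ℝ) →ᵇ ℝ))).topologicalClosure

/-- The uniform measure on doubled configurations (not normalised). -/
noncomputable def doubledMeasure : Measure (Λ → ℝ × ℝ) :=
  Measure.pi fun _ => (volume.restrict (Set.Icc (0 : ℝ) (2 * π))).prod
    (volume.restrict (Set.Icc (0 : ℝ) (2 * π)))

instance : IsFiniteMeasure (doubledMeasure Λ) := by
  unfold doubledMeasure
  infer_instance

variable {Λ}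

theorem isClosed_ginibreCone : IsClosed (ginibreCone Λ : Set ((Λ → ℝ × ℝ) →ᵇ ℝ)) :=
  Subsemiring.isClosed_topologicalClosure _

theorem mem_ginibreCone_of_mem_monomials {F : (Λ → ℝ × ℝ) →ᵇ ℝ} (hF : F ∈ ginibreMonomials Λ) :
    F ∈ ginibreCone Λ :=
  Subsemiring.le_topologicalClosure _ (Subsemiring.subset_closure hF)

theorem algebraMap_mem_ginibreCone {r : ℝ} (hr : 0 ≤ r) :
    algebraMap ℝ ((Λ → ℝ × ℝ) →ᵇ ℝ) r ∈ ginibreCone Λ :=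
  mem_ginibreCone_of_mem_monomials ⟨r, hr, 0, 0, 0, 0, fun p => by simp [ginibreMonomial]⟩

theorem integral_nonneg_of_mem_ginibreCone {F : (Λ → ℝ × ℝ) →ᵇ ℝ} (hF : F ∈ ginibreCone Λ) :
    0 ≤ ∫ p, F p ∂doubledMeasure Λ := by
  have hcl : IsClosed {F : (Λ → ℝ × ℝ) →ᵇ ℝ | 0 ≤ ∫ p, F p ∂doubledMeasure Λ} := by
    refine isClosed_le continuous_const (LipschitzWith.continuous
      (K := ((doubledMeasure Λ).real Set.univ).toNNReal) (LipschitzWith.of_dist_le_mul fun F G => ?_))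
    rw [dist_eq_norm, dist_eq_norm, ← integral_sub (F.integrable _) (G.integrable _),
      Real.coe_toNNReal _ measureReal_nonneg]
    exact (F - G).norm_integral_le_mul_norm _
  refine closure_minimal (fun G hG => ?_) hcl hF
  rw [Subsemiring.coe_closure_eq, Submonoid.closure_eq] at hG
  induction hG using AddSubmonoid.closure_induction with
  | mem G hG =>
    obtain ⟨r, hr, a, b, c, d, hG⟩ := hG
    simp only [Set.mem_ofPred_eq, hG, integral_const_mul, doubledMeasure]
    rw [integral_fintype_prod_eq_prod
      (fun x => ginibreMonomial (a x) (b x) (c x) (d x))]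
    exact mul_nonneg hr (Finset.prod_nonneg fun x _ => integral_ginibreMonomial_nonneg _ _ _ _)
  | zero => simp
  | add G H _ _ hG hH =>
    simp only [Set.mem_ofPred_eq, coe_add, Pi.add_apply] at hG hH ⊢
    rw [integral_add (G.integrable _) (H.integrable _)]
    exact add_nonneg hG hH

/-- Observables whose symmetric and antisymmetric doublings both lie in the Ginibre cone. -/
noncomputable def ginibreObservables : Subsemiring ((Λ → ℝ) →ᵇ ℝ) :=
  (ginibrePairs (ginibreCone Λ) (algebraMap_mem_ginibreCone (by positivity))).comap
    (firstCopy.prod secondCopy)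

/-- Observables for which the doublings lie in the Ginibre cone, with the copies exchanged. -/
noncomputable def ginibreCoobservables : Subsemiring ((Λ → ℝ) →ᵇ ℝ) :=
  (ginibrePairs (ginibreCone Λ) (algebraMap_mem_ginibreCone (by positivity))).comap
    (secondCopy.prod firstCopy)

theorem isClosed_ginibreObservables :
    IsClosed (ginibreObservables (Λ := Λ) : Set ((Λ → ℝ) →ᵇ ℝ)) :=
  (isClosed_ginibrePairs (algebraMap_mem_ginibreCone (by positivity))
    isClosed_ginibreCone).preimage
    (continuous_firstCopy.prodMk continuous_secondCopy)

theorem isClosed_ginibreCoobservables :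
    IsClosed (ginibreCoobservables (Λ := Λ) : Set ((Λ → ℝ) →ᵇ ℝ)) :=
  (isClosed_ginibrePairs (algebraMap_mem_ginibreCone (by positivity))
    isClosed_ginibreCone).preimage
    (continuous_secondCopy.prodMk continuous_firstCopy)

theorem algebraMap_mem_ginibreObservables {r : ℝ} (hr : 0 ≤ r) :
    algebraMap ℝ ((Λ → ℝ) →ᵇ ℝ) r ∈ ginibreObservables := by
  have h := algebraMap_mem_ginibreCone (Λ := Λ) hr
  refine ⟨add_mem h h, ?_⟩
  convert zero_mem (ginibreCone Λ) using 1
  exact sub_self _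

theorem algebraMap_mem_ginibreCoobservables {r : ℝ} (hr : 0 ≤ r) :
    algebraMap ℝ ((Λ → ℝ) →ᵇ ℝ) r ∈ ginibreCoobservables := by
  have h := algebraMap_mem_ginibreCone (Λ := Λ) hr
  refine ⟨add_mem h h, ?_⟩
  convert zero_mem (ginibreCone Λ) using 1
  exact sub_self _

theorem apply_mem_ginibreCone (F : (Λ → ℝ × ℝ) →ᵇ ℝ) (x : Λ) {a b c d : ℕ}
    (hF : ∀ p, F p = ginibreMonomial a b c d (p x)) : F ∈ ginibreCone Λ := by
  classical
  refine mem_ginibreCone_of_mem_monomials ⟨1, zero_le_one, Pi.single x a, Pi.single x b,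
    Pi.single x c, Pi.single x d, fun p => ?_⟩
  rw [one_mul, Fintype.prod_eq_single x fun y hy => by simp [ginibreMonomial, hy], hF]
  simp

theorem cosAt_mem_ginibreObservables (x : Λ) : cosAt x ∈ ginibreObservables :=
  ⟨apply_mem_ginibreCone _ x (a := 1) (b := 0) (c := 0) (d := 0) fun p => by
      simp [ginibreMonomial],
    apply_mem_ginibreCone _ x (a := 0) (b := 1) (c := 0) (d := 0) fun p => by
      simp [ginibreMonomial]⟩

theorem sinAt_mem_ginibreCoobservables (x : Λ) : sinAt x ∈ ginibreCoobservables :=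
  ⟨apply_mem_ginibreCone _ x (a := 0) (b := 0) (c := 1) (d := 0) fun p => by
      simp [ginibreMonomial, add_comm],
    apply_mem_ginibreCone _ x (a := 0) (b := 0) (c := 0) (d := 1) fun p => by
      simp [ginibreMonomial]⟩

/-- The observable `-β H`. -/
noncomputable def xyExponent (J1 J2 : Finset Λ → ℝ) (β : ℝ) : (Λ → ℝ) →ᵇ ℝ :=
  ∑ A, (algebraMap ℝ _ (β * J1 A) * ∏ x ∈ A, cosAt x
    + algebraMap ℝ _ (β * J2 A) * ∏ x ∈ A, sinAt x)

theorem xyExponent_apply (J1 J2 : Finset Λ → ℝ) (β : ℝ) (φ : Λ → ℝ) :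
    xyExponent J1 J2 β φ = -β * xyHam J1 J2 φ := by
  simp only [xyExponent, xyHam, coe_sum, Finset.sum_apply, coe_add, coe_mul, Pi.add_apply,
    Pi.mul_apply, prod_cosAt_apply, prod_sinAt_apply, sigma1, sigma2, neg_mul_neg, Finset.mul_sum,
    BoundedContinuousFunction.algebraMap_apply, smul_eq_mul]
  exact Finset.sum_congr rfl fun A _ => by ring

theorem exp_doubled_xyExponent_mem_ginibreCone {J1 J2 : Finset Λ → ℝ} (hJ1 : ∀ A, 0 ≤ J1 A)
    (hJ2 : ∀ A, 0 ≤ J2 A) {β : ℝ} (hβ : 0 ≤ β) :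
    NormedSpace.exp (firstCopy (xyExponent J1 J2 β) + secondCopy (xyExponent J1 J2 β)) ∈
      ginibreCone Λ := by
  refine Subsemiring.exp_mem_of_isClosed isClosed_ginibreCone
    (fun r hr => algebraMap_mem_ginibreCone hr) ?_
  rw [xyExponent, map_sum, map_sum, ← Finset.sum_add_distrib]
  refine sum_mem fun A _ => ?_
  rw [map_add, map_add, add_add_add_comm]
  refine add_mem ?_ ?_
  · exact (mul_mem (algebraMap_mem_ginibreObservables (mul_nonneg hβ (hJ1 A)))
      (prod_mem fun x _ => cosAt_mem_ginibreObservables x)).1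
  · have h := (mul_mem (algebraMap_mem_ginibreCoobservables (mul_nonneg hβ (hJ2 A)))
      (prod_mem (t := A) fun x _ => sinAt_mem_ginibreCoobservables x)).1
    exact (add_comm _ _).subst h

/-- The uniform measure on the box of configurations. -/
theorem volume_restrict_xyBox : (volume : Measure (Λ → ℝ)).restrict (xyBox Λ) =
    Measure.pi fun _ => volume.restrict (Set.Icc (0 : ℝ) (2 * π)) := by
  rw [xyBox, volume_pi, Measure.restrict_pi_pi]

instance : IsFiniteMeasure ((volume : Measure (Λ → ℝ)).restrict (xyBox Λ)) := by
  rw [volume_restrict_xyBox]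
  infer_instance

theorem integral_doubled_mul (F G : (Λ → ℝ) →ᵇ ℝ) :
    ∫ p, firstCopy F p * secondCopy G p ∂doubledMeasure Λ =
      (∫ φ in xyBox Λ, F φ) * ∫ φ in xyBox Λ, G φ := by
  rw [volume_restrict_xyBox, ← integral_prod_mul]
  exact (measurePreserving_arrowProdEquivProdArrow ℝ ℝ Λ
    (fun _ => volume.restrict (Set.Icc (0 : ℝ) (2 * π)))
    (fun _ => volume.restrict (Set.Icc (0 : ℝ) (2 * π)))).integral_comp'
    (fun q : (Λ → ℝ) × (Λ → ℝ) => F q.1 * G q.2)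

theorem integral_doubled_covariance (F G W : (Λ → ℝ) →ᵇ ℝ) :
    ∫ p, ((firstCopy F - secondCopy F) * (firstCopy G - secondCopy G) *
      (firstCopy W * secondCopy W)) p ∂doubledMeasure Λ =
    2 * ((∫ φ in xyBox Λ, (F * G * W) φ) * (∫ φ in xyBox Λ, W φ) -
      (∫ φ in xyBox Λ, (F * W) φ) * ∫ φ in xyBox Λ, (G * W) φ) := by
  have hexp : (firstCopy F - secondCopy F) * (firstCopy G - secondCopy G) *
      (firstCopy W * secondCopy W) =
      (firstCopy (F * G * W) * secondCopy W + firstCopy W * secondCopy (F * G * W)) -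
      (firstCopy (F * W) * secondCopy (G * W) + firstCopy (G * W) * secondCopy (F * W)) := by
    simp only [map_mul]
    ring
  have hadd : ∀ P Q : (Λ → ℝ × ℝ) →ᵇ ℝ, ∫ p, (P + Q) p ∂doubledMeasure Λ =
      ∫ p, P p ∂doubledMeasure Λ + ∫ p, Q p ∂doubledMeasure Λ := fun P Q =>
    integral_add (P.integrable _) (Q.integrable _)
  have hsub : ∀ P Q : (Λ → ℝ × ℝ) →ᵇ ℝ, ∫ p, (P - Q) p ∂doubledMeasure Λ =
      ∫ p, P p ∂doubledMeasure Λ - ∫ p, Q p ∂doubledMeasure Λ := fun P Q =>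
    integral_sub (P.integrable _) (Q.integrable _)
  have hmul : ∀ P Q : (Λ → ℝ) →ᵇ ℝ, ∫ p, (firstCopy P * secondCopy Q) p ∂doubledMeasure Λ =
      (∫ φ in xyBox Λ, P φ) * ∫ φ in xyBox Λ, Q φ := integral_doubled_mul
  rw [hexp, hsub, hadd, hadd, hmul, hmul, hmul, hmul]
  ring

theorem exp_xyExponent_apply (J1 J2 : Finset Λ → ℝ) (β : ℝ) (φ : Λ → ℝ) :
    NormedSpace.exp (xyExponent J1 J2 β) φ = Real.exp (-β * xyHam J1 J2 φ) := by
  rw [BoundedContinuousFunction.exp_apply, xyExponent_apply]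

theorem integral_exp_xyBox_pos (F : (Λ → ℝ) →ᵇ ℝ) :
    0 < ∫ φ in xyBox Λ, NormedSpace.exp F φ := by
  have hne : NeZero ((volume : Measure (Λ → ℝ)).restrict (xyBox Λ)) := by
    refine ⟨fun h => ?_⟩
    rw [Measure.restrict_eq_zero, xyBox, volume_pi_pi, Finset.prod_eq_zero_iff] at h
    simp [Real.volume_Icc, pi_pos.not_ge] at h
  have hint := (NormedSpace.exp F).integrable ((volume : Measure (Λ → ℝ)).restrict (xyBox Λ))
  simp only [funext (BoundedContinuousFunction.exp_apply F)] at hint ⊢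
  exact integral_exp_pos hint

/-- **Ginibre's inequality**: observables in the same class are positively correlated. -/
theorem ginibre_inequality {J1 J2 : Finset Λ → ℝ} (hJ1 : ∀ A, 0 ≤ J1 A)
    (hJ2 : ∀ A, 0 ≤ J2 A) {β : ℝ} (hβ : 0 ≤ β) {F G : (Λ → ℝ) →ᵇ ℝ}
    (hF : F ∈ ginibreObservables) (hG : G ∈ ginibreObservables) :
    (∫ φ in xyBox Λ, (F * NormedSpace.exp (xyExponent J1 J2 β)) φ) *
      (∫ φ in xyBox Λ, (G * NormedSpace.exp (xyExponent J1 J2 β)) φ) ≤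
    (∫ φ in xyBox Λ, (F * G * NormedSpace.exp (xyExponent J1 J2 β)) φ) *
      ∫ φ in xyBox Λ, NormedSpace.exp (xyExponent J1 J2 β) φ := by
  have h : (firstCopy F - secondCopy F) * (firstCopy G - secondCopy G) ∈ ginibreCone Λ :=
    mul_mem hF.2 hG.2
  have hpos := integral_nonneg_of_mem_ginibreCone
    (mul_mem h (exp_doubled_xyExponent_mem_ginibreCone hJ1 hJ2 hβ))
  rw [exp_doubled, integral_doubled_covariance] at hpos
  linarith

/-- **Ginibre's inequality**: observables in opposite classes are negatively correlated. -/
theorem ginibre_inequality_of_mem_coobservables {J1 J2 : Finset Λ → ℝ} (hJ1 : ∀ A, 0 ≤ J1 A)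
    (hJ2 : ∀ A, 0 ≤ J2 A) {β : ℝ} (hβ : 0 ≤ β) {F G : (Λ → ℝ) →ᵇ ℝ}
    (hF : F ∈ ginibreObservables) (hG : G ∈ ginibreCoobservables) :
    (∫ φ in xyBox Λ, (F * G * NormedSpace.exp (xyExponent J1 J2 β)) φ) *
      (∫ φ in xyBox Λ, NormedSpace.exp (xyExponent J1 J2 β) φ) ≤
    (∫ φ in xyBox Λ, (F * NormedSpace.exp (xyExponent J1 J2 β)) φ) *
      ∫ φ in xyBox Λ, (G * NormedSpace.exp (xyExponent J1 J2 β)) φ := by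
  have h : (firstCopy F - secondCopy F) * (firstCopy (-G) - secondCopy (-G)) ∈
      ginibreCone Λ := by
    rw [map_neg firstCopy, map_neg secondCopy, neg_sub_neg]
    exact mul_mem hF.2 hG.2
  have hpos := integral_nonneg_of_mem_ginibreCone
    (mul_mem h (exp_doubled_xyExponent_mem_ginibreCone hJ1 hJ2 hβ))
  rw [exp_doubled, integral_doubled_covariance] at hpos
  have hneg : ∀ P : (Λ → ℝ) →ᵇ ℝ, ∫ φ in xyBox Λ, (-P) φ = -∫ φ in xyBox Λ, P φ := fun P =>
    integral_neg P
  have h1 : F * -G * NormedSpace.exp (xyExponent J1 J2 β) =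
      -(F * G * NormedSpace.exp (xyExponent J1 J2 β)) := by ring
  have h2 : -G * NormedSpace.exp (xyExponent J1 J2 β) =
      -(G * NormedSpace.exp (xyExponent J1 J2 β)) := by ring
  rw [h1, h2, hneg, hneg] at hpos
  linarith

theorem xyExponent_of_eq_off_left {J1 J1' J2 : Finset Λ → ℝ} {Y : Finset Λ}
    (h : ∀ A, A ≠ Y → J1 A = J1' A) (β : ℝ) :
    xyExponent J1' J2 β = algebraMap ℝ _ (β * (J1' Y - J1 Y)) * ∏ x ∈ Y, cosAt x +
      xyExponent J1 J2 β := by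
  rw [← sub_eq_iff_eq_add, xyExponent, xyExponent, ← Finset.sum_sub_distrib,
    Finset.sum_eq_single Y (fun A _ hA => by rw [h A hA, sub_self])
      (fun hY => absurd (Finset.mem_univ Y) hY), mul_sub, map_sub]
  ring

theorem xyExponent_of_eq_off_right {J1 J2 J2' : Finset Λ → ℝ} {Y : Finset Λ}
    (h : ∀ A, A ≠ Y → J2 A = J2' A) (β : ℝ) :
    xyExponent J1 J2' β = algebraMap ℝ _ (β * (J2' Y - J2 Y)) * ∏ x ∈ Y, sinAt x +
      xyExponent J1 J2 β := by
  rw [← sub_eq_iff_eq_add, xyExponent, xyExponent, ← Finset.sum_sub_distrib,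
    Finset.sum_eq_single Y (fun A _ hA => by rw [h A hA, sub_self])
      (fun hY => absurd (Finset.mem_univ Y) hY), mul_sub, map_sub]
  ring

theorem xyGibbs_sigma1_eq (J1 J2 : Finset Λ → ℝ) (β : ℝ) (X : Finset Λ) :
    xyGibbs J1 J2 β (sigma1 X) =
      (∫ φ in xyBox Λ, ((∏ x ∈ X, cosAt x) * NormedSpace.exp (xyExponent J1 J2 β)) φ) /
        ∫ φ in xyBox Λ, NormedSpace.exp (xyExponent J1 J2 β) φ := by
  simp only [xyGibbs, coe_mul, Pi.mul_apply, prod_cosAt_apply, exp_xyExponent_apply]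

end Cone

/-- Monotonicity of classical XY correlations in the couplings: `⟨σ¹_X⟩` is nondecreasing in
`J¹_Y` and nonincreasing in `J²_Y`, all couplings being nonnegative. -/
theorem classical_xy_monotone_couplings {Λ : Type*} [Fintype Λ]
    (J1 J1' J2 J2' : Finset Λ → ℝ)
    (hJ1 : ∀ A : Finset Λ, 0 ≤ J1 A) (hJ1' : ∀ A : Finset Λ, 0 ≤ J1' A)
    (hJ2 : ∀ A : Finset Λ, 0 ≤ J2 A) (hJ2' : ∀ A : Finset Λ, 0 ≤ J2' A)
    (X Y : Finset Λ) (β : ℝ) (hβ : 0 < β) :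
    ((∀ A : Finset Λ, A ≠ Y → J1 A = J1' A) → J1 Y ≤ J1' Y →
      xyGibbs J1 J2 β (sigma1 X) ≤ xyGibbs J1' J2 β (sigma1 X)) ∧
    ((∀ A : Finset Λ, A ≠ Y → J2 A = J2' A) → J2 Y ≤ J2' Y →
      xyGibbs J1 J2' β (sigma1 X) ≤ xyGibbs J1 J2 β (sigma1 X)) := by
  have hXmem : ∏ x ∈ X, cosAt x ∈ ginibreObservables :=
    prod_mem fun x _ => cosAt_mem_ginibreObservables x
  refine ⟨fun h hY => ?_, fun h hY => ?_⟩
  · have hG := Subsemiring.exp_mem_of_isClosed isClosed_ginibreObservables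
      (fun r hr => algebraMap_mem_ginibreObservables hr)
      (mul_mem (algebraMap_mem_ginibreObservables (mul_nonneg hβ.le (sub_nonneg.2 hY)))
        (prod_mem (t := Y) fun x _ => cosAt_mem_ginibreObservables x))
    have hcorr := ginibre_inequality hJ1 hJ2 hβ.le hXmem hG
    rw [mul_assoc (∏ x ∈ X, cosAt x), ← exp_add_eq_mul, ← xyExponent_of_eq_off_left h] at hcorr
    rw [xyGibbs_sigma1_eq, xyGibbs_sigma1_eq,
      div_le_div_iff₀ (integral_exp_xyBox_pos _) (integral_exp_xyBox_pos _)]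
    exact hcorr
  · have hG := Subsemiring.exp_mem_of_isClosed isClosed_ginibreCoobservables
      (fun r hr => algebraMap_mem_ginibreCoobservables hr)
      (mul_mem (algebraMap_mem_ginibreCoobservables (mul_nonneg hβ.le (sub_nonneg.2 hY)))
        (prod_mem (t := Y) fun x _ => sinAt_mem_ginibreCoobservables x))
    have hcorr := ginibre_inequality_of_mem_coobservables hJ1 hJ2 hβ.le hXmem hG
    rw [mul_assoc (∏ x ∈ X, cosAt x), ← exp_add_eq_mul, ← xyExponent_of_eq_off_right h] at hcorr
    rw [xyGibbs_sigma1_eq, xyGibbs_sigma1_eq,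
      div_le_div_iff₀ (integral_exp_xyBox_pos _) (integral_exp_xyBox_pos _)]
    exact hcorr
end

section
/- (Griffiths first inequality.) Assume J_A ≥ 0 for all A ⊆ Λ. Then for every B ⊆ Λ and every β > 0 the Ising Gibbs expectation satisfies ⟨s_B⟩ ≥ 0. -/
open MeasureTheory Real

/-- The ±1 value of an Ising spin encoded by a Boolean. -/
def isingSpin (b : Bool) : ℝ := if b then 1 else -1

/-- Ising Hamiltonian with many-body couplings: `H(s) = −Σ_{A⊆Λ} J_A ∏_{x∈A} s_x`. -/
noncomputable def isingHam {Λ : Type*} [Fintype Λ] (J : Finset Λ → ℝ) (s : Λ → Bool) : ℝ :=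
  - ∑ A : Finset Λ, J A * ∏ x ∈ A, isingSpin (s x)

/-- Ising Gibbs expectation at inverse temperature `β`:
`⟨f⟩ = Z⁻¹ Σ_s f(s) e^{−βH(s)}`. -/
noncomputable def isingGibbs {Λ : Type*} [Fintype Λ] [DecidableEq Λ] (J : Finset Λ → ℝ)
    (β : ℝ) (f : (Λ → Bool) → ℝ) : ℝ :=
  (∑ s : Λ → Bool, f s * Real.exp (-β * isingHam J s)) /
  (∑ s : Λ → Bool, Real.exp (-β * isingHam J s))

/-- `s_B = ∏_{x∈B} s_x`. -/
def isingSigma {Λ : Type*} (B : Finset Λ) (s : Λ → Bool) : ℝ :=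
  ∏ x ∈ B, isingSpin (s x)

theorem isingSpin_mul_self (b : Bool) : isingSpin b * isingSpin b = 1 := by
  cases b <;> simp [isingSpin]

theorem isingSigma_eq_one_or_eq_neg_one {Λ : Type*} (B : Finset Λ) (s : Λ → Bool) :
    isingSigma B s = 1 ∨ isingSigma B s = -1 := by
  rw [← mul_self_eq_one_iff, isingSigma, ← Finset.prod_mul_distrib]
  exact Finset.prod_eq_one fun x _ => isingSpin_mul_self (s x)

theorem isingSigma_mul {Λ : Type*} [Fintype Λ] [DecidableEq Λ] (A B : Finset Λ)
    (s : Λ → Bool) : isingSigma A s * isingSigma B s = isingSigma (symmDiff A B) s := by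
  have h : ∀ C : Finset Λ, isingSigma C s = ∏ x, if x ∈ C then isingSpin (s x) else 1 :=
    fun C => by simp [isingSigma]
  simp only [h, ← Finset.prod_mul_distrib]
  refine Finset.prod_congr rfl fun x _ => ?_
  by_cases hA : x ∈ A <;> by_cases hB : x ∈ B <;>
    simp [hA, hB, Finset.mem_symmDiff, isingSpin_mul_self]

theorem sum_isingSigma_nonneg {Λ : Type*} [Fintype Λ] [DecidableEq Λ] (B : Finset Λ) :
    0 ≤ ∑ s : Λ → Bool, isingSigma B s := by
  have h : ∑ s : Λ → Bool, isingSigma B s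
      = ∏ x : Λ, ∑ b : Bool, if x ∈ B then isingSpin b else 1 := by
    rw [Finset.prod_univ_sum, Fintype.piFinset_univ]
    exact Finset.sum_congr rfl fun s _ => by simp [isingSigma]
  rw [h]
  refine Finset.prod_nonneg fun x _ => ?_
  split_ifs <;> simp [isingSpin]

theorem exp_mul_isingSigma {Λ : Type*} (c : ℝ) (A : Finset Λ) (s : Λ → Bool) :
    Real.exp (c * isingSigma A s) = Real.cosh c + isingSigma A s * Real.sinh c := by
  rcases isingSigma_eq_one_or_eq_neg_one A s with h | h
  · rw [h, mul_one, one_mul, Real.cosh_add_sinh]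
  · rw [h, mul_neg_one, neg_one_mul, ← sub_eq_add_neg, Real.cosh_sub_sinh]

theorem sum_isingSigma_mul_prod_exp_nonneg {Λ : Type*} [Fintype Λ] [DecidableEq Λ]
    (c : Finset Λ → ℝ) (hc : ∀ A, 0 ≤ c A) (S : Finset (Finset Λ)) (B : Finset Λ) :
    0 ≤ ∑ s : Λ → Bool, isingSigma B s * ∏ A ∈ S, Real.exp (c A * isingSigma A s) := by
  induction S using Finset.induction_on generalizing B with
  | empty => simpa using sum_isingSigma_nonneg B
  | insert A S hA ih =>
    have h : ∑ s : Λ → Bool, isingSigma B s * ∏ A ∈ insert A S, Real.exp (c A * isingSigma A s)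
        = Real.cosh (c A) *
            ∑ s : Λ → Bool, isingSigma B s * ∏ A ∈ S, Real.exp (c A * isingSigma A s)
          + Real.sinh (c A) * ∑ s : Λ → Bool,
            isingSigma (symmDiff B A) s * ∏ A ∈ S, Real.exp (c A * isingSigma A s) := by
      rw [Finset.mul_sum, Finset.mul_sum, ← Finset.sum_add_distrib]
      refine Finset.sum_congr rfl fun s _ => ?_
      rw [Finset.prod_insert hA, exp_mul_isingSigma (c A), ← isingSigma_mul]
      ring
    rw [h]
    exact add_nonneg (mul_nonneg (Real.cosh_pos _).le (ih B))
      (mul_nonneg (Real.sinh_nonneg_iff.2 (hc A)) (ih _))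

theorem exp_neg_mul_isingHam {Λ : Type*} [Fintype Λ] (J : Finset Λ → ℝ) (β : ℝ)
    (s : Λ → Bool) : Real.exp (-β * isingHam J s)
      = ∏ A : Finset Λ, Real.exp (β * J A * isingSigma A s) := by
  simp only [isingHam, isingSigma, neg_mul_neg, ← Real.exp_sum, Finset.mul_sum, mul_assoc]

/-- Griffiths' first inequality: `⟨s_B⟩ ≥ 0` for ferromagnetic couplings. -/
theorem ising_griffiths_first {Λ : Type*} [Fintype Λ] [DecidableEq Λ]
    (J : Finset Λ → ℝ) (hJ : ∀ A : Finset Λ, 0 ≤ J A)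
    (B : Finset Λ) (β : ℝ) (hβ : 0 < β) :
    0 ≤ isingGibbs J β (isingSigma B) := by
  refine div_nonneg ?_ (Finset.sum_nonneg fun s _ => (Real.exp_pos _).le)
  simp only [exp_neg_mul_isingHam]
  exact sum_isingSigma_mul_prod_exp_nonneg _ (fun A => mul_nonneg hβ.le (hJ A)) _ B
end
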